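/- Let n be a natural number, let f : (Fin n → ℂ) → ℂ be entire (Differentiable ℂ f), let x ∈ ℂⁿ, and let μ ≥ 1 be a natural number. Assume f vanishes to order exactly μ at x, i.e. iteratedFDeriv ℂ k f x = 0 for every k < μ while iteratedFDeriv ℂ μ f x ≠ 0. Then there exists j : Fin n such that the partial derivative g = ∂f/∂z_j (i.e. g(z) = (fderiv ℂ f z)(e_j)) vanishes to order exactly μ − 1 at x: iteratedFDeriv ℂ k g x = 0 for every k < μ − 1, and iteratedFDeriv ℂ (μ − 1) g x ≠ 0. -/

import Mathlib

open MeasureTheory Metric Set Filter Topology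

section Holomorphic

variable {E : Type*} [NormedAddCommGroup E] [NormedSpace ℂ E] {f : E → ℂ}

lemma Differentiable.hasDerivAt_comp_add_smul (hf : Differentiable ℂ f) (z v : E) :
    HasDerivAt (fun ζ : ℂ => f (z + ζ • v)) (fderiv ℂ f z v) 0 := by
  have h : HasDerivAt (fun ζ : ℂ => z + ζ • v) v 0 := by
    simpa using ((hasDerivAt_id (0 : ℂ)).smul_const v).const_add z
  have hz : HasFDerivAt f (fderiv ℂ f z) (z + (0 : ℂ) • v) := by
    simpa using (hf z).hasFDerivAt
  exact hz.comp_hasDerivAt (0 : ℂ) h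

/-- Cauchy's estimate for the Fréchet derivative on a unit ball. -/
lemma Differentiable.norm_fderiv_le_of_forall_mem_closedBall (hf : Differentiable ℂ f) {z : E}
    {C : ℝ} (hC : ∀ y ∈ closedBall z 1, ‖f y‖ ≤ C) : ‖fderiv ℂ f z‖ ≤ C := by
  have hC0 : 0 ≤ C := (norm_nonneg _).trans (hC z (mem_closedBall_self zero_le_one))
  refine ContinuousLinearMap.opNorm_le_bound _ hC0 fun v => ?_
  rcases eq_or_ne v 0 with rfl | hv
  · simp
  have hv' : 0 < ‖v‖ := norm_pos_iff.2 hv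
  have hd : Differentiable ℂ (fun ζ : ℂ => f (z + ζ • v)) := hf.comp (by fun_prop)
  have := Complex.norm_deriv_le_of_forall_mem_sphere_norm_le (c := 0) (C := C) (inv_pos.2 hv')
    hd.diffContOnCl fun ζ hζ => hC _ <| by
      rw [mem_sphere_zero_iff_norm] at hζ
      simp [norm_smul, hζ, hv'.ne']
  rwa [(hf.hasDerivAt_comp_add_smul z v).deriv, div_inv_eq_mul] at this

lemma Differentiable.fderiv_apply_eq_circleIntegral (hf : Differentiable ℂ f) (z v : E) :
    fderiv ℂ f z v =
      (2 * Real.pi * Complex.I : ℂ)⁻¹ • ∮ ζ in C(0, 1), (1 / ζ ^ 2) • f (z + ζ • v) := by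
  have hd : Differentiable ℂ (fun ζ : ℂ => f (z + ζ • v)) := hf.comp (by fun_prop)
  have := hd.diffContOnCl.deriv_eq_smul_circleIntegral (c := 0) zero_lt_one
  rw [(hf.hasDerivAt_comp_add_smul z v).deriv] at this
  rw [eq_inv_smul_iff₀ Complex.two_pi_I_ne_zero, ← this]
  simp only [sub_zero]

variable [FiniteDimensional ℂ E]

/-- Directional derivatives of an entire function are entire. -/
lemma Differentiable.fderiv_apply_const (hf : Differentiable ℂ f) (v : E) :
    Differentiable ℂ fun z => fderiv ℂ f z v := by
  have := FiniteDimensional.proper ℂ E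
  borelize E
  intro z₀
  simp_rw [hf.fderiv_apply_eq_circleIntegral]
  suffices h : DifferentiableAt ℂ
      (fun z => ∮ ζ in C(0, 1), (1 / ζ ^ 2) • f (z + ζ • v)) z₀ from
    h.fun_const_smul _
  obtain ⟨C, hC⟩ := (isCompact_closedBall z₀ (2 + ‖v‖)).exists_bound_of_continuousOn
    hf.continuous.continuousOn
  let k : ℝ → ℂ := fun θ => _root_.deriv (circleMap 0 1) θ * (1 / circleMap 0 1 θ ^ 2)
  have hk : Continuous k := by
    have : ∀ θ, circleMap 0 1 θ ^ 2 ≠ 0 := fun θ => by simp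
    simp only [k, deriv_circleMap]
    fun_prop (disch := assumption)
  have hkn : ∀ θ, ‖k θ‖ = 1 := fun θ => by simp [k]
  have hbound : ∀ θ, ∀ z ∈ ball z₀ 1, ‖k θ • fderiv ℂ f (z + circleMap 0 1 θ • v)‖ ≤ C := by
    intro θ z hz
    rw [norm_smul, hkn, one_mul]
    refine hf.norm_fderiv_le_of_forall_mem_closedBall fun y hy => hC y ?_
    rw [mem_closedBall, dist_eq_norm] at hy ⊢
    rw [mem_ball, dist_eq_norm] at hz
    calc ‖y - z₀‖ = ‖(y - (z + circleMap 0 1 θ • v)) + (z - z₀) + circleMap 0 1 θ • v‖ := by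
          congr 1; abel
      _ ≤ 1 + 1 + ‖v‖ := by
          refine (norm_add₃_le).trans ?_
          gcongr
          simp [norm_smul]
      _ = 2 + ‖v‖ := by ring
  have hcont : ∀ z, Continuous fun θ => k θ • f (z + circleMap 0 1 θ • v) := fun z =>
    hk.smul (hf.continuous.comp (by fun_prop))
  have key := intervalIntegral.hasFDerivAt_integral_of_dominated_of_fderiv_le (𝕜 := ℂ)
    (μ := volume) (a := 0) (b := 2 * Real.pi) (bound := fun _ => C)
    (F := fun z θ => k θ • f (z + circleMap 0 1 θ • v))
    (F' := fun z θ => k θ • fderiv ℂ f (z + circleMap 0 1 θ • v))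
    (ball_mem_nhds z₀ one_pos)
    (.of_forall fun z => (hcont z).aestronglyMeasurable)
    ((hcont z₀).intervalIntegrable _ _)
    (hk.aestronglyMeasurable.smul
      ((measurable_fderiv ℂ f).comp (by fun_prop)).aestronglyMeasurable)
    (.of_forall fun θ _ => hbound θ)
    intervalIntegrable_const
    (.of_forall fun θ _ z _ => ((hasFDerivAt_comp_add_right _).2 (hf _).hasFDerivAt).const_smul (k θ))
  simpa only [circleIntegral, smul_smul, smul_eq_mul, k, mul_assoc] using key.differentiableAt

lemma Differentiable.contDiff_nat (m : ℕ) (hf : Differentiable ℂ f) : ContDiff ℂ m f := by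
  induction m generalizing f with
  | zero => exact contDiff_zero.2 hf.continuous
  | succ m ih =>
    push_cast
    exact contDiff_succ_iff_fderiv_apply.2 ⟨hf, by simp, fun v => ih (hf.fderiv_apply_const v)⟩

/-- Differentiating an entire function once in the direction `v` and then `k` times amounts to
differentiating it `k + 1` times, with `v` as the last argument. -/
lemma Differentiable.iteratedFDeriv_fderiv_apply_const (hf : Differentiable ℂ f) (k : ℕ)
    (x v : E) (m : Fin k → E) :
    iteratedFDeriv ℂ k (fun z => fderiv ℂ f z v) x m =
      iteratedFDeriv ℂ (k + 1) f x (Fin.snoc m v) := by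
  have hc : ContDiff ℂ k (fderiv ℂ f) :=
    contDiff_clm_apply_iff.2 fun v => (hf.fderiv_apply_const v).contDiff_nat k
  rw [iteratedFDeriv_clm_apply_const_apply hc le_rfl, iteratedFDeriv_succ_apply_right,
    Fin.init_snoc, Fin.snoc_last]

end Holomorphic

/-- If an entire function `f` on `ℂⁿ` vanishes to order exactly `μ ≥ 1` at `x`,
then some partial derivative `∂f/∂z_j` vanishes to order exactly `μ - 1` at `x`. -/
theorem exists_partialDeriv_vanishing_order_pred
    (n : ℕ) (f : (Fin n → ℂ) → ℂ) (hf : Differentiable ℂ f)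
    (x : Fin n → ℂ) (μ : ℕ) (hμ : 1 ≤ μ)
    (hlow : ∀ k < μ, iteratedFDeriv ℂ k f x = 0)
    (htop : iteratedFDeriv ℂ μ f x ≠ 0) :
    ∃ j : Fin n,
      (∀ k < μ - 1,
        iteratedFDeriv ℂ k (fun z => fderiv ℂ f z (Pi.single j 1)) x = 0) ∧
      iteratedFDeriv ℂ (μ - 1) (fun z => fderiv ℂ f z (Pi.single j 1)) x ≠ 0 := by
  obtain ⟨m, rfl⟩ := Nat.exists_eq_add_of_le' hμ
  simp only [Nat.add_sub_cancel]
  suffices h : ∃ j : Fin n,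
      iteratedFDeriv ℂ m (fun z => fderiv ℂ f z (Pi.single j 1)) x ≠ 0 by
    obtain ⟨j, hj⟩ := h
    refine ⟨j, fun k hk => ?_, hj⟩
    ext w
    rw [hf.iteratedFDeriv_fderiv_apply_const, hlow (k + 1) (by omega)]
    rfl
  by_contra! h
  refine htop (ContinuousMultilinearMap.ext fun w => ?_)
  have hL : iteratedFDeriv ℂ m (fderiv ℂ f) x (Fin.init w) = 0 := by
    refine ContinuousLinearMap.coe_injective ((Pi.basisFun ℂ (Fin n)).ext fun j => ?_)
    have := hf.iteratedFDeriv_fderiv_apply_const m x (Pi.single j 1) (Fin.init w)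
    rw [h j, iteratedFDeriv_succ_apply_right, Fin.init_snoc, Fin.snoc_last] at this
    simpa using this.symm
  rw [iteratedFDeriv_succ_apply_right, hL]
  rfl
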